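/- (Theorem 2, regret against time-varying strategies.) Let Θ ⊆ ℝ^d be open convex, Φ : Θ → ℝ strictly convex, twice continuously differentiable with ∇²Φ(θ) ⪰ 2H·I for all θ ∈ Θ for some H > 0, and let Λ ⊆ Θ be compact and convex with M = (1/2)·sup_{θ∈Λ} ‖∇Φ(θ)‖ < ∞ and D = max_{θ,θ′∈Λ} D(θ ‖ θ′). Fix T ≥ 1, arbitrary points z_1,…,z_T ∈ Z, h : Z → ℝ^d, and K = (1/2)·max_{1≤t≤T} ‖h(z_t)‖. Let θ̂_1 ∈ Λ and, for t ≥ 1 with step size η_t = 1/√t, let θ̃_{t+1} ∈ Θ satisfy ∇Φ(θ̃_{t+1}) = ∇Φ(θ̂_t) − η_t (∇Φ(θ̂_t) − h(z_t)) and θ̂_{t+1} = argmin_{θ∈Λ} D(θ̃_{t+1} ‖ θ). Then for every sequence θ_1, θ_2, … in Λ: ∑_{t=1}^T ℓ̂(θ̂_t, z_t) ≤ ∑_{t=1}^T ℓ̂(θ_t, z_t) + D(θ̂_1 ‖ θ_1) + D·√(T+1) + 4M·√T·V_T + ((K + M)²/H)·(2√T − 1), where V_T = ∑_{t=1}^T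 ‖θ_t − θ_{t+1}‖. -/

import Mathlib

open scoped RealInnerProductSpace

/-- Bregman (Kullback–Leibler) divergence `D(θ₁‖θ₂) = Φ(θ₂) − Φ(θ₁) − ⟨∇Φ(θ₁), θ₂ − θ₁⟩`
induced by a potential `Φ` with gradient map `Φ'`. -/
noncomputable def klDiv {d : ℕ}
    (Φ : EuclideanSpace ℝ (Fin d) → ℝ)
    (Φ' : EuclideanSpace ℝ (Fin d) → EuclideanSpace ℝ (Fin d))
    (θ₁ θ₂ : EuclideanSpace ℝ (Fin d)) : ℝ :=
  Φ θ₂ - Φ θ₁ - ⟪Φ' θ₁, θ₂ - θ₁⟫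

/-- The filtering loss `ℓ̂(θ, z) = −⟨θ, h(z)⟩ + Φ(θ)`. -/
noncomputable def filterLoss {d : ℕ} {Z : Type*}
    (Φ : EuclideanSpace ℝ (Fin d) → ℝ)
    (h : Z → EuclideanSpace ℝ (Fin d))
    (θ : EuclideanSpace ℝ (Fin d)) (z : Z) : ℝ :=
  -⟪θ, h z⟫ + Φ θ

/-- Second-order Taylor lower bound on `[0, 1]` for a function whose second derivative is at least
`2 * c`. -/
lemma add_add_le_of_second_deriv_ge {f f' f'' : ℝ → ℝ} {c : ℝ}
    (hf : ∀ s ∈ Set.Icc (0 : ℝ) 1, HasDerivAt f (f' s) s)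
    (hf' : ∀ s ∈ Set.Icc (0 : ℝ) 1, HasDerivAt f' (f'' s) s)
    (hc : ∀ s ∈ Set.Icc (0 : ℝ) 1, 2 * c ≤ f'' s) :
    f 0 + f' 0 + c ≤ f 1 := by
  have hslope : ∀ s ∈ Set.Icc (0 : ℝ) 1,
      HasDerivAt (fun s => f' s - 2 * c * s) (f'' s - 2 * c) s := fun s hs => by
    refine ((hf' s hs).sub ((hasDerivAt_id s).const_mul (2 * c))).congr_deriv ?_
    rw [mul_one]
  have hslope_mono : MonotoneOn (fun s => f' s - 2 * c * s) (Set.Icc 0 1) := by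
    refine monotoneOn_of_hasDerivWithinAt_nonneg (convex_Icc 0 1)
      (fun s hs => (hslope s hs).continuousAt.continuousWithinAt)
      (fun s hs => (hslope s (interior_subset hs)).hasDerivWithinAt)
      (fun s hs => sub_nonneg.2 (hc s (interior_subset hs)))
  have hdiff : ∀ s ∈ Set.Icc (0 : ℝ) 1,
      HasDerivAt (fun s => f s - s * f' 0 - c * s ^ 2) (f' s - f' 0 - 2 * c * s) s := by
    intro s hs
    have := ((hf s hs).sub ((hasDerivAt_id s).mul_const (f' 0))).sub
      (((hasDerivAt_id s).pow 2).const_mul c)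
    refine this.congr_deriv ?_
    simp
    ring
  have hmono : MonotoneOn (fun s => f s - s * f' 0 - c * s ^ 2) (Set.Icc 0 1) := by
    refine monotoneOn_of_hasDerivWithinAt_nonneg (convex_Icc 0 1)
      (fun s hs => (hdiff s hs).continuousAt.continuousWithinAt)
      (fun s hs => (hdiff s (interior_subset hs)).hasDerivWithinAt) (fun s hs => ?_)
    have hs' := interior_subset hs
    have := hslope_mono (Set.left_mem_Icc.2 zero_le_one) hs' hs'.1
    simp only at this
    linarith
  have := hmono (Set.left_mem_Icc.2 zero_le_one) (Set.right_mem_Icc.2 zero_le_one) zero_le_one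
  simp only at this
  linarith

section Bregman

variable {d : ℕ} {Θ Λ : Set (EuclideanSpace ℝ (Fin d))} {Φ : EuclideanSpace ℝ (Fin d) → ℝ}
  {Φ' : EuclideanSpace ℝ (Fin d) → EuclideanSpace ℝ (Fin d)}

/-- A lower bound on the Hessian makes the Bregman divergence dominate the squared distance. -/
lemma mul_norm_sq_le_klDiv
    {Φ'' : EuclideanSpace ℝ (Fin d) → (EuclideanSpace ℝ (Fin d) →L[ℝ] EuclideanSpace ℝ (Fin d))} {H : ℝ}
    (hΘconv : Convex ℝ Θ) (hgrad : ∀ θ ∈ Θ, HasGradientAt Φ (Φ' θ) θ)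
    (hhess : ∀ θ ∈ Θ, HasFDerivAt Φ' (Φ'' θ) θ)
    (hlb : ∀ θ ∈ Θ, ∀ v : EuclideanSpace ℝ (Fin d), 2 * H * ‖v‖ ^ 2 ≤ ⟪v, Φ'' θ v⟫)
    {a b : EuclideanSpace ℝ (Fin d)} (ha : a ∈ Θ) (hb : b ∈ Θ) :
    H * ‖b - a‖ ^ 2 ≤ klDiv Φ Φ' a b := by
  have hmem : ∀ s ∈ Set.Icc (0 : ℝ) 1, a + s • (b - a) ∈ Θ := fun s hs =>
    hΘconv.add_smul_sub_mem ha hb hs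
  have hline : ∀ s : ℝ, HasDerivAt (fun s : ℝ => a + s • (b - a)) (b - a) s := fun s => by
    simpa using ((hasDerivAt_id s).smul_const (b - a)).const_add a
  have := add_add_le_of_second_deriv_ge (c := H * ‖b - a‖ ^ 2)
    (f := fun s => Φ (a + s • (b - a)))
    (f' := fun s => ⟪b - a, Φ' (a + s • (b - a))⟫)
    (f'' := fun s => ⟪b - a, Φ'' (a + s • (b - a)) (b - a)⟫)
    (fun s hs => by
      have := (hgrad _ (hmem s hs)).hasFDerivAt.comp_hasDerivAt s (hline s)
      simpa [real_inner_comm, Function.comp_def] using this)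
    (fun s hs => by
      have := (hasDerivAt_const s (b - a)).inner ℝ
        ((hhess _ (hmem s hs)).comp_hasDerivAt s (hline s))
      simpa [Function.comp_def] using this)
    (fun s hs => by linarith [hlb _ (hmem s hs) (b - a)])
  simp only [zero_smul, add_zero, one_smul, add_sub_cancel, real_inner_comm] at this
  unfold klDiv
  linarith

lemma klDiv_three_point (x y u : EuclideanSpace ℝ (Fin d)) :
    ⟪Φ' x - Φ' y, x - u⟫ = klDiv Φ Φ' x u + klDiv Φ Φ' y x - klDiv Φ Φ' y u := by
  simp only [klDiv, inner_sub_left, inner_sub_right]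
  ring

/-- Generalized Pythagorean inequality for the Bregman projection onto a convex set. -/
lemma klDiv_add_klDiv_le_of_isMinOn (hΛconv : Convex ℝ Λ) {x y u : EuclideanSpace ℝ (Fin d)}
    (hgrad : HasGradientAt Φ (Φ' x) x) (hx : x ∈ Λ) (hu : u ∈ Λ)
    (hmin : IsMinOn (klDiv Φ Φ' y) Λ x) :
    klDiv Φ Φ' y x + klDiv Φ Φ' x u ≤ klDiv Φ Φ' y u := by
  have hderiv : HasFDerivAt (klDiv Φ Φ' y)
      (InnerProductSpace.toDual ℝ (EuclideanSpace ℝ (Fin d)) (Φ' x) - innerSL ℝ (Φ' y)) x := by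
    have hlin : HasFDerivAt (fun θ => ⟪Φ' y, θ - y⟫) (innerSL ℝ (Φ' y)) x :=
      ((innerSL ℝ (Φ' y)).hasFDerivAt.comp x ((hasFDerivAt_id x).sub_const y)).congr_fderiv
        (ContinuousLinearMap.comp_id _)
    exact (hgrad.hasFDerivAt.sub_const (Φ y)).sub hlin
  have := hmin.localize.hasFDerivWithinAt_nonneg hderiv.hasFDerivWithinAt
    (sub_mem_posTangentConeAt_of_segment_subset (hΛconv.segment_subset hx hu))
  rw [sub_apply, InnerProductSpace.toDual_apply_apply, innerSL_apply_apply] at this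
  have hthree := klDiv_three_point (Φ := Φ) (Φ' := Φ') x y u
  simp only [inner_sub_left, inner_sub_right] at hthree this
  linarith

/-- Moving the second argument raises the divergence by at most a multiple of the distance moved. -/
lemma klDiv_le_klDiv_add {M : ℝ} {x u v : EuclideanSpace ℝ (Fin d)} (hvu : 0 ≤ klDiv Φ Φ' v u)
    (hx : ‖Φ' x‖ ≤ 2 * M) (hv : ‖Φ' v‖ ≤ 2 * M) :
    klDiv Φ Φ' x v ≤ klDiv Φ Φ' x u + 4 * M * ‖u - v‖ := by
  have hid : klDiv Φ Φ' x v = klDiv Φ Φ' x u - klDiv Φ Φ' v u + ⟪Φ' x - Φ' v, u - v⟫ := by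
    simp only [klDiv, inner_sub_left, inner_sub_right]
    ring
  have hnorm : ‖Φ' x - Φ' v‖ ≤ 4 * M := by linarith [norm_sub_le (Φ' x) (Φ' v)]
  have := (real_inner_le_norm (Φ' x - Φ' v) (u - v)).trans
    (mul_le_mul_of_nonneg_right hnorm (norm_nonneg _))
  linarith

/-- One step of mirror descent with gradient `g` and step size `η`. -/
lemma mirror_step_le {H C η : ℝ} (hH : 0 < H) (hη : 0 < η) (hΛconv : Convex ℝ Λ)
    {x y x' u g : EuclideanSpace ℝ (Fin d)} (hgrad : HasGradientAt Φ (Φ' x') x')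
    (hx' : x' ∈ Λ) (hu : u ∈ Λ) (hmin : IsMinOn (klDiv Φ Φ' y) Λ x')
    (hstrong : H * ‖x' - x‖ ^ 2 ≤ klDiv Φ Φ' x x')
    (hdual : Φ' y = Φ' x - η • g) (hg : ‖g‖ ≤ 2 * C) :
    ⟪g, x - u⟫ ≤ η⁻¹ * (klDiv Φ Φ' x u - klDiv Φ Φ' x' u) + C ^ 2 / H * η := by
  have hpyth := klDiv_add_klDiv_le_of_isMinOn hΛconv hgrad hx' hu hmin
  have hsub : Φ' x - Φ' y = η • g := by rw [hdual]; abel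
  have hxu := klDiv_three_point (Φ := Φ) (Φ' := Φ') x y u
  have hxx' := klDiv_three_point (Φ := Φ) (Φ' := Φ') x y x'
  rw [hsub, real_inner_smul_left] at hxu hxx'
  have hcs : ⟪g, x - x'⟫ ≤ 2 * C * ‖x' - x‖ := by
    rw [norm_sub_rev]
    exact (real_inner_le_norm _ _).trans (mul_le_mul_of_nonneg_right hg (norm_nonneg _))
  have hcs' := mul_le_mul_of_nonneg_left hcs hη.le
  have hquad : η * (2 * C * ‖x' - x‖) - H * ‖x' - x‖ ^ 2 ≤ C ^ 2 / H * η ^ 2 := by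
    have : C ^ 2 / H * η ^ 2 - (η * (2 * C * ‖x' - x‖) - H * ‖x' - x‖ ^ 2)
        = (C * η - H * ‖x' - x‖) ^ 2 / H := by
      field_simp
      ring
    linarith [div_nonneg (sq_nonneg (C * η - H * ‖x' - x‖)) hH.le]
  have hstep : η * ⟪g, x - u⟫
      ≤ klDiv Φ Φ' x u - klDiv Φ Φ' x' u + C ^ 2 / H * η ^ 2 := by linarith
  calc ⟪g, x - u⟫ = η⁻¹ * (η * ⟪g, x - u⟫) := by field_simp
    _ ≤ η⁻¹ * (klDiv Φ Φ' x u - klDiv Φ Φ' x' u + C ^ 2 / H * η ^ 2) :=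
      mul_le_mul_of_nonneg_left hstep (inv_nonneg.2 hη.le)
    _ = _ := by field_simp

lemma filterLoss_sub_filterLoss {Z : Type*} (h : Z → EuclideanSpace ℝ (Fin d))
    (x u : EuclideanSpace ℝ (Fin d)) (z : Z) :
    filterLoss Φ h x z - filterLoss Φ h u z = ⟪Φ' x - h z, x - u⟫ - klDiv Φ Φ' x u := by
  simp only [filterLoss, klDiv, inner_sub_left, inner_sub_right, real_inner_comm]
  ring

end Bregman

/-- Abel summation bound for a sequence bounded above by `B`. -/
lemma sum_sqrt_mul_sub_le {a : ℕ → ℝ} {B : ℝ} (ha : ∀ t, 1 ≤ t → a t ≤ B) {T : ℕ} (hT : 1 ≤ T) :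
    ∑ t ∈ Finset.Icc 1 T, √t * (a t - a (t + 1)) ≤ a 1 + B * (√T - 1) - √T * a (T + 1) := by
  induction T, hT using Nat.le_induction with
  | base => simp
  | succ n hn ih =>
    rw [Finset.sum_Icc_succ_top (by omega)]
    have hsqrt : √n ≤ √(n + 1 : ℕ) := Real.sqrt_le_sqrt (by push_cast; linarith)
    have := mul_le_mul_of_nonneg_left (ha (n + 1) (by omega)) (sub_nonneg.2 hsqrt)
    linarith

lemma sum_one_div_sqrt_le {T : ℕ} (hT : 1 ≤ T) :
    ∑ t ∈ Finset.Icc 1 T, 1 / √t ≤ 2 * √T - 1 := by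
  induction T, hT using Nat.le_induction with
  | base => norm_num
  | succ n hn ih =>
    rw [Finset.sum_Icc_succ_top (by omega)]
    have hpos : 0 < √(n + 1 : ℕ) := Real.sqrt_pos.2 (by positivity)
    have hsq : √(n + 1 : ℕ) ^ 2 = n + 1 := by rw [Real.sq_sqrt (by positivity)]; push_cast; ring
    have hsq' : √n ^ 2 = (n : ℝ) := Real.sq_sqrt (by positivity)
    have : 1 / √(n + 1 : ℕ) ≤ 2 * √(n + 1 : ℕ) - 2 * √n := by
      rw [div_le_iff₀ hpos]
      nlinarith [sq_nonneg (√(n + 1 : ℕ) - √n)]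
    linarith

/-- **Theorem 2 (regret against time-varying strategies).** -/
theorem regret_time_varying
    {d : ℕ} {Θ Λ : Set (EuclideanSpace ℝ (Fin d))}
    (hΘopen : IsOpen Θ) (hΘconv : Convex ℝ Θ)
    {Φ : EuclideanSpace ℝ (Fin d) → ℝ}
    {Φ' : EuclideanSpace ℝ (Fin d) → EuclideanSpace ℝ (Fin d)}
    {Φ'' : EuclideanSpace ℝ (Fin d) →
      (EuclideanSpace ℝ (Fin d) →L[ℝ] EuclideanSpace ℝ (Fin d))}
    (hstrict : StrictConvexOn ℝ Θ Φ)
    (hgrad : ∀ θ ∈ Θ, HasGradientAt Φ (Φ' θ) θ)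
    (hhess : ∀ θ ∈ Θ, HasFDerivAt Φ' (Φ'' θ) θ)
    (hhesscont : ContinuousOn Φ'' Θ)
    {H : ℝ} (hH : 0 < H)
    (hlb : ∀ θ ∈ Θ, ∀ v : EuclideanSpace ℝ (Fin d), 2 * H * ‖v‖ ^ 2 ≤ ⟪v, Φ'' θ v⟫)
    (hΛΘ : Λ ⊆ Θ) (hΛcompact : IsCompact Λ) (hΛconv : Convex ℝ Λ)
    {M : ℝ} (hM : IsLUB ((fun θ => (1 / 2 : ℝ) * ‖Φ' θ‖) '' Λ) M)
    {Dmax : ℝ}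
    (hD : IsGreatest ((fun p : EuclideanSpace ℝ (Fin d) × EuclideanSpace ℝ (Fin d) =>
      klDiv Φ Φ' p.1 p.2) '' (Λ ×ˢ Λ)) Dmax)
    {T : ℕ} (hT : 1 ≤ T)
    {Z : Type*} (z : ℕ → Z) (h : Z → EuclideanSpace ℝ (Fin d))
    {K : ℝ} (hK : IsGreatest ((fun t => (1 / 2 : ℝ) * ‖h (z t)‖) '' Set.Icc 1 T) K)
    (θhat θtil : ℕ → EuclideanSpace ℝ (Fin d))
    (hinit : θhat 1 ∈ Λ)
    (hdualmem : ∀ t, 1 ≤ t → θtil (t + 1) ∈ Θ)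
    (hdual : ∀ t, 1 ≤ t →
      Φ' (θtil (t + 1))
        = Φ' (θhat t) - (1 / Real.sqrt t) • (Φ' (θhat t) - h (z t)))
    (hprojmem : ∀ t, 1 ≤ t → θhat (t + 1) ∈ Λ)
    (hproj : ∀ t, 1 ≤ t → ∀ θ ∈ Λ,
      klDiv Φ Φ' (θtil (t + 1)) (θhat (t + 1)) ≤ klDiv Φ Φ' (θtil (t + 1)) θ) :
    ∀ θseq : ℕ → EuclideanSpace ℝ (Fin d), (∀ t, θseq t ∈ Λ) →
      ∑ t ∈ Finset.Icc 1 T, filterLoss Φ h (θhat t) (z t)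
        ≤ ∑ t ∈ Finset.Icc 1 T, filterLoss Φ h (θseq t) (z t)
          + klDiv Φ Φ' (θhat 1) (θseq 1)
          + Dmax * Real.sqrt (T + 1)
          + 4 * M * Real.sqrt T * (∑ t ∈ Finset.Icc 1 T, ‖θseq t - θseq (t + 1)‖)
          + ((K + M) ^ 2 / H) * (2 * Real.sqrt T - 1) := by
  intro u hu
  have hstrong : ∀ {a b}, a ∈ Λ → b ∈ Λ → H * ‖b - a‖ ^ 2 ≤ klDiv Φ Φ' a b := fun ha hb =>
    mul_norm_sq_le_klDiv hΘconv hgrad hhess hlb (hΛΘ ha) (hΛΘ hb)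
  have hnonneg : ∀ {a b}, a ∈ Λ → b ∈ Λ → 0 ≤ klDiv Φ Φ' a b := fun ha hb =>
    (by positivity : (0 : ℝ) ≤ H * _).trans (hstrong ha hb)
  have hle : ∀ {a b}, a ∈ Λ → b ∈ Λ → klDiv Φ Φ' a b ≤ Dmax := fun {a b} ha hb =>
    hD.2 ⟨(a, b), ⟨ha, hb⟩, rfl⟩
  have hΦ' : ∀ {a}, a ∈ Λ → ‖Φ' a‖ ≤ 2 * M := fun {a} ha => by
    have : (1 / 2 : ℝ) * ‖Φ' a‖ ≤ M := hM.1 ⟨a, ha, rfl⟩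
    linarith
  have hM0 : 0 ≤ M := by linarith [norm_nonneg (Φ' (θhat 1)), hΦ' hinit]
  have hhat : ∀ t, 1 ≤ t → θhat t ∈ Λ := fun t ht => by
    obtain rfl | ht' := ht.eq_or_lt
    · exact hinit
    · obtain ⟨s, rfl⟩ : ∃ s, t = s + 1 := ⟨t - 1, by omega⟩
      exact hprojmem s (by omega)
  set a : ℕ → ℝ := fun t => klDiv Φ Φ' (θhat t) (u t)
  have hround : ∀ t ∈ Finset.Icc 1 T,
      filterLoss Φ h (θhat t) (z t) ≤ filterLoss Φ h (u t) (z t) + √t * (a t - a (t + 1))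
        + 4 * M * √T * ‖u t - u (t + 1)‖ + (K + M) ^ 2 / H * (1 / √t) := by
    intro t ht
    obtain ⟨h1t, htT⟩ := Finset.mem_Icc.1 ht
    have hx := hhat t h1t
    have hx' := hprojmem t h1t
    have hg : ‖Φ' (θhat t) - h (z t)‖ ≤ 2 * (K + M) := by
      have : (1 / 2 : ℝ) * ‖h (z t)‖ ≤ K := hK.2 ⟨t, ⟨h1t, htT⟩, rfl⟩
      linarith [norm_sub_le (Φ' (θhat t)) (h (z t)), hΦ' hx]
    have hη : 0 < 1 / √(t : ℝ) := one_div_pos.2 (Real.sqrt_pos.2 (by exact_mod_cast h1t))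
    have hstep := mirror_step_le hH hη hΛconv (hgrad _ (hΛΘ hx')) hx' (hu t)
      (hproj t h1t) (hstrong hx hx') (hdual t h1t) hg
    rw [one_div, inv_inv, ← one_div] at hstep
    have hdrift : a (t + 1) ≤ _ := klDiv_le_klDiv_add (hnonneg (hu (t + 1)) (hu t))
      (hΦ' hx') (hΦ' (hu (t + 1)))
    have hdrift' := mul_le_mul_of_nonneg_left hdrift (Real.sqrt_nonneg t)
    have hsqrt : √(t : ℝ) ≤ √T := Real.sqrt_le_sqrt (by exact_mod_cast htT)
    have hmove := mul_le_mul_of_nonneg_right hsqrt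
      (by positivity : 0 ≤ 4 * M * ‖u t - u (t + 1)‖)
    have hloss := filterLoss_sub_filterLoss (Φ := Φ) (Φ' := Φ') h (θhat t) (u t) (z t)
    have ha0 : 0 ≤ a t := hnonneg hx (hu t)
    simp only [a] at *
    linarith
  have hsum := Finset.sum_le_sum hround
  simp only [Finset.sum_add_distrib, ← Finset.mul_sum] at hsum
  have habel := sum_sqrt_mul_sub_le (a := a) (fun t ht => hle (hhat t ht) (hu t)) hT
  have hlast : 0 ≤ √(T : ℝ) * a (T + 1) :=
    mul_nonneg (Real.sqrt_nonneg _) (hnonneg (hhat _ (by omega)) (hu _))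
  have hDmax : 0 ≤ Dmax := (hnonneg hinit hinit).trans (hle hinit hinit)
  have hroot : √(T : ℝ) - 1 ≤ √(T + 1 : ℝ) := by
    linarith [Real.sqrt_le_sqrt (by linarith : (T : ℝ) ≤ T + 1)]
  have hDroot := mul_le_mul_of_nonneg_left hroot hDmax
  have hsteps := mul_le_mul_of_nonneg_left (sum_one_div_sqrt_le hT)
    (by positivity : 0 ≤ (K + M) ^ 2 / H)
  linarith
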